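/- Assume (A1)–(A4), let p ∈ [1,∞), and let ℛ : L^p(Ω, ℬ, ℙ) → ℝ be convex and monotone (ℛ[Y₁] ≤ ℛ[Y₂] whenever Y₁ ≤ Y₂ ℙ-a.s.). Then the function 𝒬_ℛ : 𝒰_Υ → ℝ defined by 𝒬_ℛ[u] := ℛ[Φ[u ⊙ Υ]] is continuous; in particular, if 𝒰_Υ is in addition nonempty and compact, then there exists u* ∈ 𝒰_Υ with 𝒬_ℛ[u*] ≤ 𝒬_ℛ[u] for all u ∈ 𝒰_Υ. -/

import Mathlib

open Matrix Set

/-- The lower-level quadratic objective `f ↦ fᵀ M H[u]⁻¹ M f`. -/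
noncomputable def lowerObj {n N : ℕ} (M : Matrix (Fin N) (Fin N) ℝ)
    (H : (Fin n → ℝ) → Matrix (Fin N) (Fin N) ℝ)
    (u : Fin n → ℝ) (f : Fin N → ℝ) : ℝ :=
  f ⬝ᵥ ((M * (H u)⁻¹ * M) *ᵥ f)

/-- The lower-level optimal value function `ψ[u] = max_{f ∈ ℱ} fᵀ M H[u]⁻¹ M f`. -/
noncomputable def psiVal {n N : ℕ} (M : Matrix (Fin N) (Fin N) ℝ)
    (H : (Fin n → ℝ) → Matrix (Fin N) (Fin N) ℝ)
    (F : Set (Fin N → ℝ)) (u : Fin n → ℝ) : ℝ :=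
  sSup (lowerObj M H u '' F)

/-- The lower-level solution set mapping `Ψ[u] = {f ∈ ℱ : fᵀ M H[u]⁻¹ M f = ψ[u]}`. -/
noncomputable def PsiSet {n N : ℕ} (M : Matrix (Fin N) (Fin N) ℝ)
    (H : (Fin n → ℝ) → Matrix (Fin N) (Fin N) ℝ)
    (F : Set (Fin N → ℝ)) (u : Fin n → ℝ) : Set (Fin N → ℝ) :=
  {f ∈ F | lowerObj M H u f = psiVal M H F u}

/-- The pessimistic value function `Φ[u] = max_{f ∈ Ψ[u]} J[u,f]`. -/
noncomputable def PhiVal {n N : ℕ} (M : Matrix (Fin N) (Fin N) ℝ)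
    (H : (Fin n → ℝ) → Matrix (Fin N) (Fin N) ℝ)
    (F : Set (Fin N → ℝ)) (J : (Fin n → ℝ) → (Fin N → ℝ) → ℝ)
    (u : Fin n → ℝ) : ℝ :=
  sSup ((J u) '' PsiSet M H F u)

/-- The topological support of a Borel measure: points all of whose open
neighbourhoods have positive measure. -/
def measSupport {α : Type*} [TopologicalSpace α] [MeasurableSpace α]
    (μ : MeasureTheory.Measure α) : Set α :=
  {x | ∀ s : Set α, IsOpen s → x ∈ s → 0 < μ s}

open MeasureTheory Filter Topology Metric in
/-- The zero set of a real analytic function on a connected open set is Lebesgue-null, unless the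
function vanishes identically. -/
theorem AnalyticOnNhd.eqOn_zero_or_measure_zeros_eq_zero {E : Type*} [NormedAddCommGroup E]
    [NormedSpace ℝ E] [FiniteDimensional ℝ E] [MeasurableSpace E] [BorelSpace E]
    (μ : Measure E) [μ.IsAddHaarMeasure] {f : E → ℝ} {s : Set E}
    (hf : AnalyticOnNhd ℝ f s) (hs : IsOpen s) (hsc : IsPreconnected s) :
    EqOn f 0 s ∨ μ {x ∈ s | f x = 0} = 0 := by
  refine or_iff_not_imp_left.2 fun hne => ?_
  refine measure_null_of_locally_null _ fun x hx => ?_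
  obtain ⟨R, hR, hRs⟩ := Metric.isOpen_iff.1 hs x hx.1
  obtain ⟨z, hz, hfz⟩ : ∃ z ∈ ball x (R / 2), f z ≠ 0 := by
    by_contra! h
    exact hne (hf.eqOn_zero_of_preconnected_of_eventuallyEq_zero hsc hx.1
      (eventually_of_mem (ball_mem_nhds x (half_pos hR)) h))
  have hzs : z ∈ s := hRs (ball_subset_ball (by linarith) hz)
  obtain ⟨r', hr', hfr'⟩ := Metric.eventually_nhds_iff_ball.1
    ((hf z hzs).continuousAt.eventually_ne hfz)
  set r := min r' (R / 2)
  have hr : 0 < r := lt_min hr' (half_pos hR)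
  have hrR : ball x r ⊆ ball x R := ball_subset_ball ((min_le_right _ _).trans (by linarith))
  refine ⟨{y ∈ s | f y = 0} ∩ ball x r,
    inter_mem_nhdsWithin _ (ball_mem_nhds x hr), ?_⟩
  have hmeas : MeasurableSet ({y ∈ s | f y = 0} ∩ ball x r) := by
    have hcl : IsOpen (s ∩ f ⁻¹' {0}ᶜ) :=
      hf.continuousOn.isOpen_inter_preimage hs isOpen_compl_singleton
    have : {y ∈ s | f y = 0} ∩ ball x r = (s \ (s ∩ f ⁻¹' {0}ᶜ)) ∩ ball x r := by
      ext y
      simp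
    rw [this]
    exact (hs.measurableSet.diff hcl.measurableSet).inter measurableSet_ball
  suffices h : ∀ᵐ y ∂μ, y ∈ ({y ∈ s | f y = 0} ∩ ball x r)ᶜ by
    exact compl_mem_ae_iff.1 h
  refine ae_mem_of_ae_add_linearMap_mem ((LinearMap.id : ℝ →ₗ[ℝ] ℝ).smulRight (z - x)) volume μ
    hmeas.compl fun y => ?_
  simp only [LinearMap.smulRight_apply, LinearMap.id_apply]
  set T : Set ℝ := {t | y + t • (z - x) ∈ ball x R}
  by_cases hy : ∃ t : ℝ, y + t • (z - x) ∈ ball x r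
  · obtain ⟨t, ht⟩ := hy
    have hTconv : Convex ℝ T := by
      have := (convex_ball x R).affine_preimage (AffineMap.lineMap y (y + (z - x)) : ℝ →ᵃ[ℝ] E)
      have hT : T = AffineMap.lineMap y (y + (z - x)) ⁻¹' ball x R := by
        ext t
        simp [T, AffineMap.lineMap_apply, add_comm]
      rwa [hT]
    have hTopen : IsOpen T := isOpen_ball.preimage (by fun_prop)
    have hg : AnalyticOnNhd ℝ (fun t : ℝ => f (y + t • (z - x))) T := fun t ht =>
      AnalyticAt.fun_comp (hf _ (hRs ht)) (by fun_prop)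
    have h1 : y + (t + 1) • (z - x) ∈ ball z r := by
      rw [mem_ball_iff_norm] at ht ⊢
      convert ht using 2
      module
    have h1T : t + 1 ∈ T := by
      rw [mem_ball] at h1 hz
      have : r ≤ R / 2 := min_le_right _ _
      refine mem_ball.2 ((dist_triangle _ z _).trans_lt ?_)
      linarith
    rcases hg.eqOn_zero_or_eventually_ne_zero_of_preconnected hTconv.isPreconnected with h0 | h0
    · exact absurd (h0 h1T) (hfr' _ (ball_subset_ball (min_le_left _ _) h1))
    · have := ae_restrict_le_codiscreteWithin (μ := volume) hTopen.measurableSet h0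
      filter_upwards [(ae_restrict_iff' hTopen.measurableSet).1 this] with t ht hmem
      exact ht (hrR hmem.2) hmem.1.2
  · push Not at hy
    exact Eventually.of_forall fun t ht => hy t ht.2

open Filter Topology in
/-- A finite-valued monotone convex function on a Banach lattice is continuous. -/
theorem ConvexOn.continuous_of_monotone {E : Type*} [NormedAddCommGroup E] [NormedSpace ℝ E]
    [CompleteSpace E] [Lattice E] [HasSolidNorm E] [IsOrderedAddMonoid E] [OrderClosedTopology E]
    {f : E → ℝ} (hf : ConvexOn ℝ univ f) (hmono : Monotone f) : Continuous f := by
  rw [← continuousOn_univ]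
  have hiff := (hf.continuousOn_tfae isOpen_univ univ_nonempty).out 1 3
  refine hiff.2 ⟨0, mem_univ _, ?_⟩
  by_contra hbdd
  have hex (k : ℕ) : ∃ y : E, ‖y‖ < (1 / 2 : ℝ) ^ k ∧ (k : ℝ) < f y := by
    by_contra! h
    exact hbdd ⟨k, eventually_map.2 (Metric.eventually_nhds_iff.2
      ⟨(1 / 2 : ℝ) ^ k, by positivity, fun y hy => h y (by simpa using hy)⟩)⟩
  choose y hy hfy using hex
  have hsum : Summable fun k => |y k| :=
    Summable.of_norm_bounded summable_geometric_two fun k => by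
      simpa [norm_abs_eq_norm] using (hy k).le
  obtain ⟨k, hk⟩ := exists_nat_gt (f (∑' k, |y k|))
  have hle : y k ≤ ∑' k, |y k| :=
    (le_abs_self _).trans (hsum.le_tsum k fun j _ => abs_nonneg _)
  linarith [hmono hle, hfy k]

/-- The strict convexity identity for a quadratic form. -/
theorem Matrix.dotProduct_mulVec_convexCombo {ι : Type*} [Fintype ι] (A : Matrix ι ι ℝ)
    (x y : ι → ℝ) {a b : ℝ} (hab : a + b = 1) :
    (a • x + b • y) ⬝ᵥ (A *ᵥ (a • x + b • y)) =
      a * (x ⬝ᵥ (A *ᵥ x)) + b * (y ⬝ᵥ (A *ᵥ y)) - a * b * ((x - y) ⬝ᵥ (A *ᵥ (x - y))) := by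
  obtain rfl : b = 1 - a := by linarith
  simp only [mulVec_add, mulVec_sub, mulVec_smul, add_dotProduct, sub_dotProduct, dotProduct_add,
    dotProduct_sub, smul_dotProduct, dotProduct_smul, smul_eq_mul]
  ring

theorem lowerObj_pos {n N : ℕ} {M : Matrix (Fin N) (Fin N) ℝ} (hM : M.PosDef)
    {H : (Fin n → ℝ) → Matrix (Fin N) (Fin N) ℝ} {u : Fin n → ℝ} (hu : (H u).PosDef)
    {f : Fin N → ℝ} (hf : f ≠ 0) : 0 < lowerObj M H u f := by
  have h := hu.inv.conjTranspose_mul_mul_same (B := M) (Matrix.mulVec_injective_of_isUnit hM.isUnit)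
  rw [hM.isHermitian.eq] at h
  simpa [lowerObj] using h.dotProduct_mulVec_pos hf

theorem lowerObj_continuous {n N : ℕ} (M : Matrix (Fin N) (Fin N) ℝ)
    (H : (Fin n → ℝ) → Matrix (Fin N) (Fin N) ℝ) (u : Fin n → ℝ) :
    Continuous (lowerObj M H u) := by
  unfold lowerObj
  fun_prop

/-- Maximizers of the strictly convex lower-level objective are extreme points. -/
theorem PsiSet_subset_extremePoints {n N : ℕ} {M : Matrix (Fin N) (Fin N) ℝ} (hM : M.PosDef)
    {H : (Fin n → ℝ) → Matrix (Fin N) (Fin N) ℝ} {F : Set (Fin N → ℝ)} (hF : IsCompact F)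
    {u : Fin n → ℝ} (hu : (H u).PosDef) : PsiSet M H F u ⊆ F.extremePoints ℝ := by
  intro f hf
  refine mem_extremePoints.2 ⟨hf.1, fun x hx y hy hxy => ?_⟩
  have hle {g} (hg : g ∈ F) : lowerObj M H u g ≤ lowerObj M H u f := by
    rw [hf.2]
    exact le_csSup (hF.image (lowerObj_continuous M H u)).bddAbove (mem_image_of_mem _ hg)
  obtain ⟨a, b, ha, hb, hab, rfl⟩ := hxy
  obtain rfl : x = y := by
    by_contra hne
    have hpos := lowerObj_pos hM hu (sub_ne_zero.2 hne)
    have heq := dotProduct_mulVec_convexCombo (M * (H u)⁻¹ * M) x y hab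
    have h1 := mul_le_mul_of_nonneg_left (hle hx) ha.le
    have h2 := mul_le_mul_of_nonneg_left (hle hy) hb.le
    have h3 := mul_pos (mul_pos ha hb) hpos
    unfold lowerObj at h1 h2 h3
    have h4 := congrArg
      (· * ((a • x + b • y) ⬝ᵥ ((M * (H u)⁻¹ * M) *ᵥ (a • x + b • y)))) hab
    simp only [add_mul, one_mul] at h4
    linarith
  simp [← add_smul, hab]

theorem PsiSet_nonempty {n N : ℕ} (M : Matrix (Fin N) (Fin N) ℝ)
    (H : (Fin n → ℝ) → Matrix (Fin N) (Fin N) ℝ) {F : Set (Fin N → ℝ)} (hF : IsCompact F)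
    (hFne : F.Nonempty) (u : Fin n → ℝ) : (PsiSet M H F u).Nonempty := by
  obtain ⟨f, hf, hfu⟩ := (hF.image (lowerObj_continuous M H u)).sSup_mem (hFne.image _)
  exact ⟨f, hf, hfu⟩

/-- The lower-level objective depends analytically on the design wherever `H` does. -/
theorem analyticOnNhd_lowerObj {n N : ℕ} (M : Matrix (Fin N) (Fin N) ℝ)
    {H : (Fin n → ℝ) → Matrix (Fin N) (Fin N) ℝ} {s : Set (Fin n → ℝ)}
    (hH : ∀ i j, AnalyticOnNhd ℝ (fun u => H u i j) s) (hdet : ∀ u ∈ s, (H u).det ≠ 0)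
    (f : Fin N → ℝ) : AnalyticOnNhd ℝ (fun u => lowerObj M H u f) s := by
  intro u hu
  have hdetana {A : (Fin n → ℝ) → Matrix (Fin N) (Fin N) ℝ}
      (hA : ∀ i j, AnalyticAt ℝ (fun u => A u i j) u) : AnalyticAt ℝ (fun u => (A u).det) u := by
    simp only [det_apply']
    exact Finset.analyticAt_fun_sum _ fun σ _ =>
      analyticAt_const.mul (Finset.analyticAt_fun_prod _ fun i _ => hA _ _)
  have hadj (i j) : AnalyticAt ℝ (fun u => (H u).adjugate i j) u := by
    simp only [adjugate_apply]
    refine hdetana fun k l => ?_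
    by_cases hk : k = j
    · subst hk
      simpa using analyticAt_const
    · simpa [hk] using hH k l u hu
  have hinv (i j) : AnalyticAt ℝ (fun u => (H u)⁻¹ i j) u := by
    simp only [inv_def, Matrix.smul_apply, Ring.inverse_eq_inv', smul_eq_mul]
    exact ((hdetana fun i j => hH i j u hu).inv (hdet u hu)).mul (hadj i j)
  simp only [lowerObj, dotProduct, mulVec, mul_apply, Finset.sum_mul, Finset.mul_sum]
  refine Finset.analyticAt_fun_sum _ fun i _ => Finset.analyticAt_fun_sum _ fun j _ =>
    Finset.analyticAt_fun_sum _ fun k _ => Finset.analyticAt_fun_sum _ fun l _ => ?_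
  exact analyticAt_const.mul
    (((analyticAt_const.mul (hinv l k)).mul analyticAt_const).mul analyticAt_const)

open Filter Topology in
/-- The pessimistic value function is continuous at every design at which ties between extreme
points in the lower-level problem persist on all of `U`. -/
theorem continuousWithinAt_PhiVal {n N : ℕ} {M : Matrix (Fin N) (Fin N) ℝ} (hM : M.PosDef)
    {H : (Fin n → ℝ) → Matrix (Fin N) (Fin N) ℝ} {F : Set (Fin N → ℝ)} (hF : IsCompact F)
    (hFne : F.Nonempty) (hfin : (F.extremePoints ℝ).Finite)
    {J : (Fin n → ℝ) → (Fin N → ℝ) → ℝ} {U : Set (Fin n → ℝ)} (hH : ∀ u ∈ U, (H u).PosDef)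
    (hq : ∀ f, ContinuousOn (fun u => lowerObj M H u f) U)
    (hJ : ∀ f, ContinuousOn (fun u => J u f) U) {v : Fin n → ℝ} (hv : v ∈ U)
    (htie : ∀ f ∈ F.extremePoints ℝ, ∀ g ∈ F.extremePoints ℝ,
      lowerObj M H v f = lowerObj M H v g → ∀ u ∈ U, lowerObj M H u f = lowerObj M H u g) :
    ContinuousWithinAt (PhiVal M H F J) U v := by
  obtain ⟨f₀, hf₀⟩ := PsiSet_nonempty M H hF hFne v
  have hsub {u} (hu : u ∈ U) := PsiSet_subset_extremePoints hM hF (hH u hu)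
  have hle (u) {g} (hg : g ∈ F) : lowerObj M H u g ≤ psiVal M H F u :=
    le_csSup (hF.image (lowerObj_continuous M H u)).bddAbove (mem_image_of_mem _ hg)
  have hlt : ∀ᶠ u in 𝓝[U] v, ∀ g ∈ F.extremePoints ℝ, g ∉ PsiSet M H F v →
      lowerObj M H u g < lowerObj M H u f₀ := by
    refine (eventually_all_finite hfin).2 fun g hg => ?_
    by_cases hgv : g ∈ PsiSet M H F v
    · exact Eventually.of_forall fun _ h => absurd hgv h
    · have : lowerObj M H v g < lowerObj M H v f₀ := by
        rw [hf₀.2]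
        exact lt_of_le_of_ne (hle v hg.1) fun h => hgv ⟨hg.1, h⟩
      filter_upwards [(hq g v hv).eventually_lt (hq f₀ v hv) this] with u hu _ using hu
  have heq : ∀ᶠ u in 𝓝[U] v, PsiSet M H F u = PsiSet M H F v := by
    filter_upwards [hlt, self_mem_nhdsWithin] with u hu huU
    have htie' {g} (hg : g ∈ PsiSet M H F v) : lowerObj M H u g = lowerObj M H u f₀ :=
      htie g (hsub hv hg) f₀ (hsub hv hf₀) (hg.2.trans hf₀.2.symm) u huU
    have hsub' {g} (hg : g ∈ PsiSet M H F u) : g ∈ PsiSet M H F v := by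
      by_contra hgv
      have := hu g (hsub huU hg) hgv
      rw [hg.2] at this
      exact this.not_ge (hle u hf₀.1)
    obtain ⟨h, hh⟩ := PsiSet_nonempty M H hF hFne u
    exact Subset.antisymm (fun g hg => hsub' hg) fun g hg =>
      ⟨hg.1, (htie' hg).trans ((htie' (hsub' hh)).symm.trans hh.2)⟩
  have hS : (PsiSet M H F v).Finite := hfin.subset (hsub hv)
  have hSne : hS.toFinset.Nonempty := ⟨f₀, by simpa using hf₀⟩
  have hcont : ContinuousWithinAt (fun u => hS.toFinset.sup' hSne (J u ·)) U v :=
    ContinuousWithinAt.finset_sup'_apply hSne fun f _ => hJ f v hv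
  have hΦ {u} (hu : PsiSet M H F u = PsiSet M H F v) :
      PhiVal M H F J u = hS.toFinset.sup' hSne (J u ·) := by
    rw [Finset.sup'_eq_csSup_image, Set.Finite.coe_toFinset, PhiVal, hu]
  exact hcont.congr_of_eventuallyEq (heq.mono fun u hu => hΦ hu) (hΦ rfl)

theorem abs_PhiVal_le {n N : ℕ} {M : Matrix (Fin N) (Fin N) ℝ}
    {H : (Fin n → ℝ) → Matrix (Fin N) (Fin N) ℝ} {F : Set (Fin N → ℝ)} (hF : IsCompact F)
    (hFne : F.Nonempty) {J : (Fin n → ℝ) → (Fin N → ℝ) → ℝ} {u : Fin n → ℝ} {C : ℝ}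
    (hC : ∀ f ∈ F, |J u f| ≤ C) : |PhiVal M H F J u| ≤ C := by
  obtain ⟨f, hf⟩ := PsiSet_nonempty M H hF hFne u
  refine abs_le.2 ⟨?_, csSup_le (image_nonempty.2 ⟨f, hf⟩) ?_⟩
  · exact (abs_le.1 (hC f hf.1)).1.trans (le_csSup
      ⟨C, forall_mem_image.2 fun g hg => (abs_le.1 (hC g hg.1)).2⟩ (mem_image_of_mem _ hf))
  · exact forall_mem_image.2 fun g hg => (abs_le.1 (hC g hg.1)).2

open MeasureTheory Filter Topology ENNReal in
/-- Bounded convergence in `L^p`, along a countably generated filter. -/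
theorem tendsto_eLpNorm_zero_of_bounded {α ι : Type*} [MeasurableSpace α] {μ : Measure α}
    [IsFiniteMeasure μ] {l : Filter ι} [l.IsCountablyGenerated] {p : ℝ≥0∞} (hp₀ : p ≠ 0)
    (hp : p ≠ ⊤) {f : ι → α → ℝ} (hf : ∀ᶠ i in l, AEStronglyMeasurable (f i) μ) {C : ℝ}
    (hC : ∀ᶠ i in l, ∀ᵐ x ∂μ, |f i x| ≤ C) (hlim : ∀ᵐ x ∂μ, Tendsto (f · x) l (𝓝 0)) :
    Tendsto (fun i => eLpNorm (f i) p μ) l (𝓝 0) := by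
  have hpos : 0 < p.toReal := toReal_pos hp₀ hp
  have hlint : Tendsto (fun i => ∫⁻ x, ‖f i x‖ₑ ^ p.toReal ∂μ) l (𝓝 (∫⁻ _, 0 ∂μ)) := by
    refine tendsto_lintegral_filter_of_dominated_convergence'
      (fun _ => ENNReal.ofReal C ^ p.toReal) ?_ ?_ ?_ ?_
    · filter_upwards [hf] with i hi using hi.enorm.pow_const _
    · filter_upwards [hC] with i hi
      filter_upwards [hi] with x hx
      gcongr
      rw [Real.enorm_eq_ofReal_abs]
      exact ofReal_le_ofReal hx
    · rw [lintegral_const]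
      exact mul_ne_top (rpow_ne_top_of_nonneg hpos.le ofReal_ne_top) (measure_ne_top _ _)
    · filter_upwards [hlim] with x hx
      have := (ENNReal.continuous_rpow_const (y := p.toReal)).tendsto 0
      rw [zero_rpow_of_pos hpos] at this
      exact this.comp (by simpa using hx.enorm)
  have := ((ENNReal.continuous_rpow_const (y := 1 / p.toReal)).tendsto _).comp hlint
  simp only [lintegral_zero, zero_rpow_of_pos (one_div_pos.2 hpos)] at this
  simpa only [eLpNorm_eq_lintegral_rpow_enorm_toReal hp₀ hp, Function.comp_def] using this

open MeasureTheory in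
theorem ae_comp_mul_left_pi {ι : Type*} [Fintype ι] {u : ι → ℝ} (hu : ∀ i, u i ≠ 0)
    {Q : (ι → ℝ) → Prop} (hQ : ∀ᵐ x, Q x) : ∀ᵐ x : ι → ℝ, Q (u * x) := by
  classical
  have hdet : LinearMap.det (toLin' (diagonal u)) ≠ 0 := by
    simpa [Finset.prod_ne_zero_iff] using hu
  have hpre := Measure.addHaar_preimage_linearMap volume hdet {x | ¬ Q x}
  rw [ae_iff.1 hQ, mul_zero] at hpre
  have hmul (x : ι → ℝ) : toLin' (diagonal u) x = u * x := by
    ext i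
    simp [mulVec_diagonal]
  simpa only [ae_iff, preimage_ofPred_eq, hmul] using hpre

open MeasureTheory in
theorem measSupport_eq_support {α : Type*} [TopologicalSpace α] [MeasurableSpace α]
    (μ : Measure α) : measSupport μ = μ.support := by
  ext x
  rw [Measure.mem_support_iff_forall]
  refine ⟨fun h s hs => ?_, fun h s hs hx => h s (hs.mem_nhds hx)⟩
  obtain ⟨t, hts, ht, hxt⟩ := mem_nhds_iff.1 hs
  exact (h t ht hxt).trans_le (measure_mono hts)

open MeasureTheory Filter ENNReal in
theorem stmt15 (n N : ℕ) (hn : 0 < n) (hN : 0 < N)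
    (U : Set (Fin n → ℝ)) (hUpos : ∀ u ∈ U, ∀ i, 0 < u i)
    (hUne : U.Nonempty) (hUcl : IsClosed U)
    (M : Matrix (Fin N) (Fin N) ℝ) (hM : M.PosDef)
    (F : Set (Fin N → ℝ)) (hFne : F.Nonempty) (hFconv : Convex ℝ F)
    (hFcomp : IsCompact F)
    (H : (Fin n → ℝ) → Matrix (Fin N) (Fin N) ℝ)
    (hHcont : ContinuousOn H U) (hHpd : ∀ u ∈ U, (H u).PosDef)
    (J : (Fin n → ℝ) → (Fin N → ℝ) → ℝ)
    (hJ : ContinuousOn (fun p : (Fin n → ℝ) × (Fin N → ℝ) => J p.1 p.2)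
      (U ×ˢ Set.univ))
    -- the underlying probability space and the random perturbation Υ
    {Ω : Type*} [MeasurableSpace Ω] (Pr : Measure Ω) [IsProbabilityMeasure Pr]
    (Υ : Ω → (Fin n → ℝ)) (hΥ : Measurable Υ)
    (hsuppne : (measSupport (Pr.map Υ)).Nonempty)
    -- (A1): the support of μ_Υ is bounded
    (hA1 : Bornology.IsBounded (measSupport (Pr.map Υ)))
    -- (A2): ℱ is the convex hull of its nonempty finite set of extreme points 𝒫
    (P : Set (Fin N → ℝ)) (hPfin : P.Finite) (hPne : P.Nonempty)
    (hFP : F = convexHull ℝ P) (hPext : P = F.extremePoints ℝ)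
    -- (A3): μ_Υ is absolutely continuous w.r.t. Lebesgue measure
    (hA3 : Pr.map Υ ≪ volume)
    -- (A4): H is real analytic on an open connected Ũ ⊇ 𝒰 with values in a
    -- closed subset of the symmetric positive definite matrices
    (Ut : Set (Fin n → ℝ)) (hUtopen : IsOpen Ut) (hUtconn : IsConnected Ut)
    (hUUt : U ⊆ Ut)
    (hHana : ∀ i j : Fin N, AnalyticOnNhd ℝ (fun u => H u i j) Ut)
    (hHcl : ∃ C : Set (Matrix (Fin N) (Fin N) ℝ), IsClosed C ∧
      (∀ A ∈ C, A.PosDef) ∧ ∀ u ∈ Ut, H u ∈ C)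
    -- the convex, monotone risk measure ℛ on L^p(Ω, ℬ, ℙ), p ∈ [1,∞)
    (p : ℝ≥0∞) [Fact (1 ≤ p)] (hp : p ≠ ⊤)
    (R : Lp ℝ p Pr → ℝ)
    (hconv : ConvexOn ℝ Set.univ R)
    (hmono : ∀ Y₁ Y₂ : Lp ℝ p Pr,
      (Y₁ : Ω → ℝ) ≤ᵐ[Pr] (Y₂ : Ω → ℝ) → R Y₁ ≤ R Y₂)
    -- G u is the element of L^p represented by ω ↦ Φ[u ⊙ Υ(ω)]
    (G : (Fin n → ℝ) → Lp ℝ p Pr)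
    (hG : ∀ u ∈ {u : Fin n → ℝ | ∀ υ ∈ measSupport (Pr.map Υ), u * υ ∈ U},
      (G u : Ω → ℝ) =ᵐ[Pr] fun ω => PhiVal M H F J (u * Υ ω)) :
    -- 𝒬_ℛ[u] = ℛ[Φ[u ⊙ Υ]] is continuous on 𝒰_Υ ...
    ContinuousOn (fun u => R (G u))
      {u : Fin n → ℝ | ∀ υ ∈ measSupport (Pr.map Υ), u * υ ∈ U} ∧
    -- ... and if 𝒰_Υ is nonempty and compact, a minimizer exists
    (({u : Fin n → ℝ | ∀ υ ∈ measSupport (Pr.map Υ), u * υ ∈ U}.Nonempty ∧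
        IsCompact {u : Fin n → ℝ | ∀ υ ∈ measSupport (Pr.map Υ), u * υ ∈ U}) →
      ∃ ustar ∈ {u : Fin n → ℝ | ∀ υ ∈ measSupport (Pr.map Υ), u * υ ∈ U},
        ∀ u ∈ {u : Fin n → ℝ | ∀ υ ∈ measSupport (Pr.map Υ), u * υ ∈ U},
          R (G ustar) ≤ R (G u)) := by
  rw [measSupport_eq_support] at *
  set V := {u : Fin n → ℝ | ∀ υ ∈ (Pr.map Υ).support, u * υ ∈ U}
  have hRcont : Continuous R :=
    hconv.continuous_of_monotone fun Y₁ Y₂ h => hmono Y₁ Y₂ ((Lp.coeFn_le Y₁ Y₂).2 h)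
  suffices hGcont : ContinuousOn G V by
    have hQ : ContinuousOn (fun u => R (G u)) V := hRcont.comp_continuousOn hGcont
    exact ⟨hQ, fun ⟨hne, hcomp⟩ => hcomp.exists_isMinOn hne hQ⟩
  have hsupp : ∀ᵐ ω ∂Pr, Υ ω ∈ (Pr.map Υ).support :=
    ae_of_ae_map hΥ.aemeasurable Measure.support_mem_ae
  have hdet : ∀ u ∈ Ut, (H u).det ≠ 0 := by
    obtain ⟨C, -, hC, hHC⟩ := hHcl
    exact fun u hu => (hC _ (hHC u hu)).det_pos.ne'
  have hana (f) : AnalyticOnNhd ℝ (fun u => lowerObj M H u f) Ut :=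
    analyticOnNhd_lowerObj M hHana hdet f
  have hJf (f) : ContinuousOn (fun u => J u f) U :=
    hJ.comp (by fun_prop : ContinuousOn (fun u => (u, f)) U) fun u hu => ⟨hu, mem_univ _⟩
  have hgeneric : ∀ᵐ x : Fin n → ℝ, x ∈ U → ContinuousWithinAt (PhiVal M H F J) U x := by
    have htie : ∀ᵐ x : Fin n → ℝ, ∀ f ∈ P, ∀ g ∈ P, x ∈ Ut → lowerObj M H x f = lowerObj M H x g →
        ∀ u ∈ U, lowerObj M H u f = lowerObj M H u g := by
      refine (eventually_all_finite hPfin).2 fun f _ => (eventually_all_finite hPfin).2 fun g _ => ?_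
      rcases ((hana f).sub (hana g)).eqOn_zero_or_measure_zeros_eq_zero volume hUtopen
        hUtconn.isPreconnected with h | h
      · exact Eventually.of_forall fun x _ _ u hu => sub_eq_zero.1 (h (hUUt hu))
      · filter_upwards [compl_mem_ae_iff.2 h] with x hx hxU hfg
        exact absurd ⟨hxU, sub_eq_zero.2 hfg⟩ hx
    filter_upwards [htie] with x hx hxU
    subst hPext
    exact continuousWithinAt_PhiVal hM hFcomp hFne hPfin hHpd
      (fun f => (hana f).continuousOn.mono hUUt) hJf hxU fun f hf g hg => hx f hf g hg (hUUt hxU)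
  intro u₀ hu₀
  have hu₀ne : ∀ i, u₀ i ≠ 0 := by
    obtain ⟨υ, hυ⟩ := hsuppne
    exact fun i => left_ne_zero_of_mul (hUpos _ (hu₀ υ hυ) i).ne'
  have hcontAt : ∀ᵐ ω ∂Pr, ContinuousWithinAt (PhiVal M H F J) U (u₀ * Υ ω) := by
    filter_upwards [hsupp, ae_of_ae_map hΥ.aemeasurable
      (hA3.ae_le (ae_comp_mul_left_pi hu₀ne hgeneric))] with ω h₁ h₂ using h₂ (hu₀ _ h₁)
  obtain ⟨C, hC⟩ : ∃ C : ℝ, ∀ u ∈ V ∩ Metric.closedBall u₀ 1, ∀ υ ∈ (Pr.map Υ).support,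
      |PhiVal M H F J (u * υ)| ≤ C := by
    have hsuppcomp : IsCompact (Pr.map Υ).support :=
      Metric.isCompact_of_isClosed_isBounded Measure.isClosed_support hA1
    have hK : IsCompact
        ((fun q : (Fin n → ℝ) × (Fin n → ℝ) => q.1 * q.2) ''
          (Metric.closedBall u₀ 1 ×ˢ (Pr.map Υ).support) ∩ U) :=
      (((isCompact_closedBall u₀ 1).prod hsuppcomp).image continuous_mul).inter_right hUcl
    obtain ⟨C, hC⟩ := (hK.prod hFcomp).exists_bound_of_continuousOn
      (hJ.mono (prod_mono inter_subset_right (subset_univ F)))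
    exact ⟨C, fun u hu υ hυ => abs_PhiVal_le hFcomp hFne fun f hf =>
      hC (u * υ, f) ⟨⟨⟨(u, υ), ⟨hu.2, hυ⟩, rfl⟩, hu.1 υ hυ⟩, hf⟩⟩
  have hball : ∀ᶠ u in nhdsWithin u₀ V, u ∈ V ∩ Metric.closedBall u₀ 1 :=
    inter_mem_nhdsWithin V (Metric.closedBall_mem_nhds u₀ one_pos)
  have hGae {u} (hu : u ∈ V) : (⇑(G u) - ⇑(G u₀) : Ω → ℝ) =ᵐ[Pr]
      fun ω => PhiVal M H F J (u * Υ ω) - PhiVal M H F J (u₀ * Υ ω) :=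
    (hG u hu).sub (hG u₀ hu₀)
  refine (Lp.tendsto_Lp_iff_tendsto_eLpNorm' G (G u₀)).2 ?_
  refine Tendsto.congr' (eventually_mem_nhdsWithin.mono fun u hu => (eLpNorm_congr_ae (hGae hu)).symm)
    (tendsto_eLpNorm_zero_of_bounded (C := C + C) (zero_lt_one.trans_le Fact.out).ne' hp ?_ ?_ ?_)
  · filter_upwards [self_mem_nhdsWithin] with u hu
    exact ((Lp.aestronglyMeasurable _).sub (Lp.aestronglyMeasurable _)).congr (hGae hu)
  · filter_upwards [hball] with u hu
    filter_upwards [hsupp] with ω hω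
    exact (abs_sub _ _).trans (add_le_add (hC u hu _ hω)
      (hC u₀ ⟨hu₀, Metric.mem_closedBall_self zero_le_one⟩ _ hω))
  · filter_upwards [hsupp, hcontAt] with ω hω hω'
    have hmul : Tendsto (fun u => u * Υ ω) (nhdsWithin u₀ V) (nhdsWithin (u₀ * Υ ω) U) :=
      tendsto_nhdsWithin_iff.2 ⟨(continuous_mul_const _).continuousWithinAt,
        eventually_mem_nhdsWithin.mono fun u hu => hu _ hω⟩
    exact tendsto_sub_nhds_zero_iff.2 (hω'.tendsto.comp hmul)
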